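/- For every Schwartz function φ : ℝ → ℂ, the limit as t → 0⁺ of (4πt)^(-1/2) e^(-iπ/4) ∫_ℝ exp(i x²/(4t)) φ(x) dx equals φ(0). Equivalently, the functions x ↦ exp(i x²/(4t)) / (4πit)^(1/2) converge to the Dirac mass at 0 in the sense of tempered distributions as t → 0⁺, where (4πit)^(1/2) = √(4πt) · e^(iπ/4). -/

import Mathlib

open MeasureTheory
open scoped FourierTransform

lemma aux_cont (f : ℝ → ℂ) (hf : Integrable f) :
    ContinuousOn (fun b : ℂ => ∫ x : ℝ, Complex.exp (-Real.pi * b * (x:ℂ)^2) * f x)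
      {b | 0 ≤ b.re} := by
  intro b hb
  apply continuousWithinAt_of_dominated (bound := fun x => ‖f x‖)
  · refine Filter.Eventually.of_forall fun b => ?_
    exact (Continuous.aestronglyMeasurable (by fun_prop)).mul hf.1
  · filter_upwards [self_mem_nhdsWithin] with c hc
    refine Filter.Eventually.of_forall fun x => ?_
    rw [norm_mul, Complex.norm_exp]
    apply mul_le_of_le_one_left (norm_nonneg _)
    rw [Real.exp_le_one_iff]
    have : (-(Real.pi:ℂ) * c * (x:ℂ)^2).re = -(Real.pi * c.re * x^2) := by
      have : (-(Real.pi:ℂ) * c * (x:ℂ)^2) = ((-(Real.pi * x^2) : ℝ):ℂ) * c := by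
        push_cast; ring
      rw [this, Complex.re_ofReal_mul]; ring
    rw [this]
    have hc' : 0 ≤ c.re := hc
    have := Real.pi_pos
    have : 0 ≤ Real.pi * c.re * x^2 := by positivity
    linarith
  · exact hf.norm
  · refine Filter.Eventually.of_forall fun x => ?_
    exact Continuous.continuousWithinAt (by fun_prop)

lemma aux_id (φ : SchwartzMap ℝ ℂ) (b : ℂ) (hb : 0 < b.re) :
    1 / b ^ (1/2 : ℂ) * ∫ x : ℝ, Complex.exp (-Real.pi * b⁻¹ * (x:ℂ)^2) * φ x
      = ∫ x : ℝ, Complex.exp (-Real.pi * b * (x:ℂ)^2) * (𝓕 φ) x := by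
  have hG : Integrable (fun x : ℝ => Complex.exp (-Real.pi * b * (x:ℂ)^2)) := by
    have := integrable_cexp_neg_mul_sq (b := Real.pi * b)
      (by rw [Complex.re_ofReal_mul]; exact mul_pos Real.pi_pos hb)
    simpa [neg_mul] using this
  have h := VectorFourier.integral_fourierIntegral_smul_eq_flip (L := innerₗ ℝ)
      Real.continuous_fourierChar continuous_inner hG φ.integrable (μ := volume) (ν := volume)
  have h1 : ∀ x, VectorFourier.fourierIntegral Real.fourierChar volume (innerₗ ℝ)
      (fun x : ℝ => Complex.exp (-Real.pi * b * (x:ℂ)^2)) x =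
       1 / b ^ (1/2 : ℂ) * Complex.exp (-Real.pi / b * (x:ℂ)^2) := 
    fun x => congrFun (fourier_gaussian_pi hb) x
  have h2 : ∀ x, VectorFourier.fourierIntegral Real.fourierChar volume (innerₗ ℝ).flip
      (fun x : ℝ => φ x) x = (𝓕 φ) x := by
    intro x
    rw [flip_innerₗ, SchwartzMap.fourier_coe]
    rfl
  simp only [h1, h2, smul_eq_mul] at h
  rw [← h, ← integral_const_mul]
  simp only [div_eq_mul_inv, mul_assoc]

lemma aux_id' (φ : SchwartzMap ℝ ℂ) (b : ℂ) (hb : b.re = 0) (hb0 : b ∈ Complex.slitPlane) :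
    1 / b ^ (1/2 : ℂ) * ∫ x : ℝ, Complex.exp (-Real.pi * b⁻¹ * (x:ℂ)^2) * φ x
      = ∫ x : ℝ, Complex.exp (-Real.pi * b * (x:ℂ)^2) * (𝓕 φ) x := by
  have hne : b ≠ 0 := Complex.slitPlane_ne_zero hb0
  set S : Set ℂ := {b | 0 < b.re}
  have hcl : b ∈ closure S := by
    rw [Complex.closure_setOfPred_lt_re]
    exact hb.ge
  haveI : (nhdsWithin b S).NeBot := mem_closure_iff_nhdsWithin_neBot.1 hcl
  have hS : S ⊆ {b | 0 ≤ b.re} := fun c hc => le_of_lt (show 0 < c.re from hc)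
  have R := ((aux_cont _ (𝓕 φ).integrable) b hb.ge).mono hS
  have L1 : ContinuousWithinAt (fun b : ℂ => 1 / b ^ (1/2:ℂ)) S b := by
    apply ContinuousAt.continuousWithinAt
    refine continuousAt_const.div (continuousAt_id.cpow continuousAt_const hb0) ?_
    simp [Complex.cpow_eq_zero_iff, hne]
  have L2 : ContinuousWithinAt (fun b : ℂ =>
      ∫ x : ℝ, Complex.exp (-Real.pi * b⁻¹ * (x:ℂ)^2) * φ x) S b := by
    refine ContinuousWithinAt.comp (t := {b | 0 ≤ b.re}) (f := fun b : ℂ => b⁻¹)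
      (g := fun b : ℂ => ∫ x : ℝ, Complex.exp (-Real.pi * b * (x:ℂ)^2) * φ x)
      (aux_cont _ φ.integrable _ ?_) (continuousAt_inv₀ hne).continuousWithinAt ?_
    · simp [Complex.inv_re, hb]
    · intro c hc
      have : 0 < c.re := hc
      simp only [Set.mem_setOf_eq, Complex.inv_re]
      exact div_nonneg this.le (Complex.normSq_nonneg _)
  refine tendsto_nhds_unique (L1.mul L2) (Filter.Tendsto.congr' ?_ R)
  filter_upwards [self_mem_nhdsWithin] with c hc
  exact (aux_id φ c hc).symm

theorem stmt_11 (φ : SchwartzMap ℝ ℂ) :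
    Filter.Tendsto
      (fun t : ℝ =>
        (((4 * Real.pi * t) ^ (-(1 / 2 : ℝ)) : ℝ) : ℂ) *
          Complex.exp (-(Complex.I * (Real.pi : ℂ)) / 4) *
          ∫ x : ℝ, Complex.exp (Complex.I * (x : ℂ) ^ 2 / (4 * (t : ℂ))) * φ x)
      (nhdsWithin 0 (Set.Ioi 0)) (nhds (φ 0)) := by
  have key : Filter.Tendsto (fun t : ℝ => ∫ x : ℝ,
      Complex.exp (-Real.pi * (((4 * Real.pi * t : ℝ) : ℂ) * Complex.I) * (x:ℂ)^2) * (𝓕 φ) x)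
      (nhdsWithin 0 (Set.Ioi 0)) (nhds (φ 0)) := by
    have h0 := aux_cont _ (𝓕 φ).integrable 0 (by simp)
    have e : (∫ x : ℝ, Complex.exp (-Real.pi * 0 * (x:ℂ)^2) * (𝓕 φ) x) = φ 0 := by
      have : φ 0 = (𝓕⁻ (𝓕 φ)) 0 := by rw [FourierTransform.fourierInv_fourier_eq]
      rw [this, SchwartzMap.fourierInv_coe, Real.fourierInv_eq]
      simp
    rw [ContinuousWithinAt, e] at h0
    refine h0.comp (tendsto_nhdsWithin_iff.2 ⟨?_, ?_⟩)
    · refine Filter.Tendsto.mono_left ?_ nhdsWithin_le_nhds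
      refine Continuous.tendsto' (by fun_prop) _ _ (by simp)
    · exact Filter.Eventually.of_forall fun t => by simp
  refine key.congr' ?_
  filter_upwards [self_mem_nhdsWithin] with t ht
  have ht : 0 < t := ht
  have hp := Real.pi_pos
  have hpos : 0 < 4 * Real.pi * t := by positivity
  rw [← aux_id' φ _ (by simp) (by simp [Complex.mem_slitPlane_iff, hp.ne', ht.ne'])]
  congr 1
  · rw [one_div, ← Complex.cpow_neg, Complex.cpow_def_of_ne_zero (by
      simp [hp.ne', ht.ne']), Complex.log_ofReal_mul hpos Complex.I_ne_zero, Complex.log_I,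
      Real.rpow_def_of_pos hpos, Complex.ofReal_exp, ← Complex.exp_add]
    congr 1
    push_cast
    ring
  · congr 1
    ext x
    congr 2
    have : (t:ℂ) ≠ 0 := by exact_mod_cast ht.ne'
    have : (Real.pi:ℂ) ≠ 0 := by exact_mod_cast hp.ne'
    push_cast
    rw [mul_inv, Complex.inv_I]
    field_simp
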